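/- Let E be a real inner product space and f : E → ℝ differentiable with L_f-Lipschitz gradient, L_f > 0, and bounded below: there is W* with f(W*) ≤ f(x) for all x ∈ E. Let T ≥ 1 and consider iterates W_0, …, W_T with W_{t+1} = W_t − η_t g_t, where 0 < η_t ≤ 1/L_f, and each error δ_t = g_t − ∇f(W_t) satisfies ‖δ_t‖² ≤ ρ ε_s and ⟪δ_t, ∇f(W_t)⟫ ≥ 0. Then, with c = L_f ρ ε_s / 2, the smallest gradient seen so far is bounded: min_{0 ≤ t ≤ T−1} ‖∇f(W_t)‖² ≤ ( f(W_0) − f(W*) + c·∑_{t=0}^{T−1} η_t² ) / ( ∑_{t=0}^{T−1} (η_t − (L_f/2)η_t²) ), the denominator being positive since η_t − (L_f/2)η_t² ≥ η_t/2 > 0. (The min-gradient bound, Eqn (11), in the proof of the paper's Theorem 1.) -/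

import Mathlib

open RealInnerProductSpace

/-- The quadratic upper bound for a function with Lipschitz gradient. -/
theorem le_add_inner_gradient_add_sq {E : Type*} [NormedAddCommGroup E] [InnerProductSpace ℝ E]
    [CompleteSpace E] {f : E → ℝ} {L : ℝ} (hf : Differentiable ℝ f)
    (hgrad : ∀ x y : E, ‖gradient f x - gradient f y‖ ≤ L * ‖x - y‖) (x v : E) :
    f (x + v) ≤ f x + ⟪gradient f x, v⟫ + L / 2 * ‖v‖ ^ 2 := by
  let φ : ℝ → ℝ := fun s => f (x + s • v) - s * ⟪gradient f x, v⟫ - L / 2 * ‖v‖ ^ 2 * s ^ 2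
  have hφ (s : ℝ) :
      HasDerivAt φ (⟪gradient f (x + s • v) - gradient f x, v⟫ - L * ‖v‖ ^ 2 * s) s := by
    have hline : HasDerivAt (fun s : ℝ => x + s • v) v s := by
      simpa using ((hasDerivAt_id s).smul_const v).const_add x
    have hcomp := (hf (x + s • v)).hasGradientAt.hasFDerivAt.comp_hasDerivAt s hline
    rw [InnerProductSpace.toDual_apply_apply] at hcomp
    have h := (hcomp.sub ((hasDerivAt_id s).mul_const ⟪gradient f x, v⟫)).sub
      ((hasDerivAt_pow 2 s).const_mul (L / 2 * ‖v‖ ^ 2))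
    refine h.congr_deriv ?_
    rw [inner_sub_left]
    norm_num
    ring
  have hanti : AntitoneOn φ (Set.Icc 0 1) := by
    refine antitoneOn_of_deriv_nonpos (convex_Icc 0 1)
      (fun s _ => (hφ s).continuousAt.continuousWithinAt)
      (fun s _ => (hφ s).differentiableAt.differentiableWithinAt) fun s hs => ?_
    rw [interior_Icc] at hs
    rw [(hφ s).deriv, sub_nonpos]
    calc ⟪gradient f (x + s • v) - gradient f x, v⟫
        ≤ ‖gradient f (x + s • v) - gradient f x‖ * ‖v‖ := real_inner_le_norm _ _
      _ ≤ L * ‖x + s • v - x‖ * ‖v‖ := by gcongr; exact hgrad _ _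
      _ = L * ‖v‖ ^ 2 * s := by
        rw [add_sub_cancel_left, norm_smul, Real.norm_of_nonneg hs.1.le]
        ring
  have h := hanti (Set.left_mem_Icc.mpr zero_le_one) (Set.right_mem_Icc.mpr zero_le_one)
    zero_le_one
  simp only [φ, one_smul, zero_smul, add_zero] at h
  linarith

/-- One step of gradient descent with an inexact gradient whose error is aligned with the true
gradient. -/
theorem inexact_gradient_step_le {E : Type*} [NormedAddCommGroup E] [InnerProductSpace ℝ E]
    [CompleteSpace E] {f : E → ℝ} {L η : ℝ} (hL : 0 < L) (hf : Differentiable ℝ f)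
    (hgrad : ∀ x y : E, ‖gradient f x - gradient f y‖ ≤ L * ‖x - y‖) (hη₀ : 0 ≤ η)
    (hη₁ : η ≤ 1 / L) {x g : E} (halign : 0 ≤ ⟪g - gradient f x, gradient f x⟫) :
    f (x - η • g) ≤ f x - (η - L / 2 * η ^ 2) * ‖gradient f x‖ ^ 2 +
      L / 2 * η ^ 2 * ‖g - gradient f x‖ ^ 2 := by
  have h := le_add_inner_gradient_add_sq hf hgrad x (-(η • g))
  rw [← sub_eq_add_neg, norm_neg, norm_smul, mul_pow, Real.norm_eq_abs, sq_abs, inner_neg_right,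
    real_inner_smul_right] at h
  have hinner : ⟪gradient f x, g⟫ =
      ‖gradient f x‖ ^ 2 + ⟪g - gradient f x, gradient f x⟫ := by
    rw [inner_sub_left, real_inner_self_eq_norm_sq, real_inner_comm]
    ring
  have hnorm : ‖g‖ ^ 2 = ‖g - gradient f x‖ ^ 2 + 2 * ⟪g - gradient f x, gradient f x⟫ +
      ‖gradient f x‖ ^ 2 := by
    rw [← norm_add_sq_real, sub_add_cancel]
  rw [hinner, hnorm] at h
  have hLη : η * L ≤ 1 := (le_div_iff₀ hL).mp hη₁
  have hcross : 0 ≤ η * (1 - η * L) * ⟪g - gradient f x, gradient f x⟫ :=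
    mul_nonneg (mul_nonneg hη₀ (sub_nonneg.mpr hLη)) halign
  linarith

/-- Min-gradient bound (Eqn (11)) in the proof of Theorem 1: with `c = L_f ρ εs / 2`,
`min_{0 ≤ t < T} ‖∇f W_t‖² ≤ (f W_0 - f W* + c ∑ η_t²) / ∑ (η_t - (L_f/2)η_t²)`. -/
theorem min_gradient_bound {E : Type*} [NormedAddCommGroup E] [InnerProductSpace ℝ E]
    [CompleteSpace E] (f : E → ℝ) (Lf ρ εs : ℝ) (hLf : 0 < Lf)
    (hf : Differentiable ℝ f)
    (hgrad : ∀ x y : E, ‖gradient f x - gradient f y‖ ≤ Lf * ‖x - y‖)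
    (Wstar : E) (hmin : ∀ x : E, f Wstar ≤ f x)
    (T : ℕ) (hT : 1 ≤ T) (W g : ℕ → E) (η : ℕ → ℝ)
    (hstep : ∀ t < T, W (t + 1) = W t - η t • g t)
    (hη₀ : ∀ t < T, 0 < η t) (hη₁ : ∀ t < T, η t ≤ 1 / Lf)
    (hδ : ∀ t < T, ‖g t - gradient f (W t)‖ ^ 2 ≤ ρ * εs)
    (halign : ∀ t < T, 0 ≤ ⟪g t - gradient f (W t), gradient f (W t)⟫) :
    (Finset.range T).inf' (Finset.nonempty_range_iff.mpr (Nat.one_le_iff_ne_zero.mp hT))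
        (fun t => ‖gradient f (W t)‖ ^ 2) ≤
      (f (W 0) - f Wstar + Lf * ρ * εs / 2 * ∑ t ∈ Finset.range T, η t ^ 2) /
        ∑ t ∈ Finset.range T, (η t - Lf / 2 * η t ^ 2) := by
  have hpos : 0 < ∑ t ∈ Finset.range T, (η t - Lf / 2 * η t ^ 2) := by
    refine Finset.sum_pos (fun t ht => ?_)
      (Finset.nonempty_range_iff.mpr (Nat.one_le_iff_ne_zero.mp hT))
    have ht := Finset.mem_range.mp ht
    have hLη : η t * Lf ≤ 1 := (le_div_iff₀ hLf).mp (hη₁ t ht)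
    nlinarith [hη₀ t ht]
  rw [le_div_iff₀ hpos, Finset.mul_sum, Finset.mul_sum]
  set m := (Finset.range T).inf' _ fun t => ‖gradient f (W t)‖ ^ 2
  have hdescent (t : ℕ) (ht : t ∈ Finset.range T) : m * (η t - Lf / 2 * η t ^ 2) ≤
      (f (W t) - f (W (t + 1))) + Lf * ρ * εs / 2 * η t ^ 2 := by
    have hm : m ≤ ‖gradient f (W t)‖ ^ 2 := Finset.inf'_le _ ht
    have ht := Finset.mem_range.mp ht
    have hLη : η t * Lf ≤ 1 := (le_div_iff₀ hLf).mp (hη₁ t ht)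
    have hcoef : 0 ≤ η t - Lf / 2 * η t ^ 2 := by nlinarith [hη₀ t ht]
    have hstep_le := inexact_gradient_step_le hLf hf hgrad (hη₀ t ht).le (hη₁ t ht) (halign t ht)
    rw [← hstep t ht] at hstep_le
    have herr := mul_le_mul_of_nonneg_left (hδ t ht)
      (mul_nonneg (half_pos hLf).le (sq_nonneg (η t)))
    linarith [mul_le_mul_of_nonneg_right hm hcoef]
  have hsum := Finset.sum_le_sum hdescent
  rw [Finset.sum_add_distrib, Finset.sum_range_sub' (fun t => f (W t))] at hsum
  linarith [hmin (W T)]
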